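/- If a finite trace tr (a list of external commands) is generated by spec from a valid state σ ≠ Wrong — i.e., evaluating spec from σ emits exactly the external commands of tr in order, restarting spec with the resulting state whenever evaluation reaches Skip and commands of tr remain — then executing tr from σ under the external-command semantics →_EC never produces the state Wrong. -/

import Mathlib

/-- Colors of items (and `empty` for an empty bay). -/
inductive Color
  | empty | red | white | blue
deriving DecidableEq, Repr

/-- The high-bay warehouse: a record of nine bays, each holding a color. -/
structure Bays where
  bay1 : Color
  bay2 : Color
  bay3 : Color
  bay4 : Color
  bay5 : Color
  bay6 : Color
  bay7 : Color
  bay8 : Color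
  bay9 : Color
deriving DecidableEq, Repr

/-- `bf b n` returns the color of bay `n` (for `1 ≤ n ≤ 9`). -/
def bf (b : Bays) : ℕ → Color
  | 1 => b.bay1
  | 2 => b.bay2
  | 3 => b.bay3
  | 4 => b.bay4
  | 5 => b.bay5
  | 6 => b.bay6
  | 7 => b.bay7
  | 8 => b.bay8
  | 9 => b.bay9
  | _ => Color.empty

/-- Update bay `n` to hold color `c`. -/
def setBay (b : Bays) (n : ℕ) (c : Color) : Bays :=
  match n with
  | 1 => { b with bay1 := c }
  | 2 => { b with bay2 := c }
  | 3 => { b with bay3 := c }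
  | 4 => { b with bay4 := c }
  | 5 => { b with bay5 := c }
  | 6 => { b with bay6 := c }
  | 7 => { b with bay7 := c }
  | 8 => { b with bay8 := c }
  | 9 => { b with bay9 := c }
  | _ => b

/-- `findColor c n b` returns the least index `m` with `n ≤ m ≤ 9` and `bf b m = c`,
or `none` if no such index exists. -/
def findColor (c : Color) (n : ℕ) (b : Bays) : Option ℕ :=
  if _h : n ≤ 9 then
    if bf b n = c then some n else findColor c (n + 1) b
  else none
termination_by 10 - n
decreasing_by omega

/-- User inputs: a request to retrieve or store an item of a given color. -/
inductive Input
  | RetrieveRequest (c : Color)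
  | StoreRequest (c : Color)
deriving DecidableEq, Repr

/-- The color requested by an input. -/
def requestedColor : Input → Color
  | .RetrieveRequest c => c
  | .StoreRequest c => c

/-- A state is either a valid state `⟨bays, input⟩` or the error state `Wrong`. -/
inductive State
  | Sigma (b : Bays) (i : Input)
  | Wrong
deriving DecidableEq, Repr

/-- External commands (RPCs). -/
inductive ExtCom
  | IsFull | NotFull | HasColor | DoesNotHaveColor
  | Store (c : Color)
  | Retrieve (c : Color)
deriving DecidableEq, Repr

/-- Atomic propositions. -/
inductive AP
  | APHasStoreRequest | APHasRetrieveRequest | APBaysFull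
  | APRequestRed | APRequestWhite | APRequestBlue
  | APContainsRed | APContainsWhite | APContainsBlue
deriving DecidableEq, Repr

/-- Internal commands of the DSL. -/
inductive IntCom
  | Skip
  | Seq (t1 t2 : IntCom)
  | If (p : AP) (t1 t2 : IntCom)
  | Ext (e : ExtCom)
deriving DecidableEq, Repr

/-- All nine bays are nonempty. -/
def baysFullB (b : Bays) : Bool :=
  (List.range' 1 9).all fun n => !(bf b n == Color.empty)

/-- Some bay holds color `c`. -/
def containsC (b : Bays) (c : Color) : Bool :=
  (List.range' 1 9).any fun n => bf b n == c

/-- Evaluation of an atomic proposition in a valid state `⟨b, i⟩`. -/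
def evalAP (p : AP) (b : Bays) (i : Input) : Bool :=
  match p with
  | .APHasStoreRequest => (match i with | .StoreRequest _ => true | _ => false)
  | .APHasRetrieveRequest => (match i with | .RetrieveRequest _ => true | _ => false)
  | .APBaysFull => baysFullB b
  | .APRequestRed => requestedColor i = Color.red
  | .APRequestWhite => requestedColor i = Color.white
  | .APRequestBlue => requestedColor i = Color.blue
  | .APContainsRed => containsC b Color.red
  | .APContainsWhite => containsC b Color.white
  | .APContainsBlue => containsC b Color.blue

/-- Evaluation of an atomic proposition in a state (no proposition holds at `Wrong`). -/
def evalAtomicProp (p : AP) : State → Bool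
  | .Sigma b i => evalAP p b i
  | .Wrong => false

/-- The labeling function `L : State → 2^AP`. -/
def labelFn (st : State) : Set AP := {p | evalAtomicProp p st = true}

/-- The atomic proposition `APContains⟨c⟩` for `c ∈ {red, white, blue}`. -/
def containsAP : Color → AP
  | .red => AP.APContainsRed
  | .white => AP.APContainsWhite
  | .blue => AP.APContainsBlue
  | .empty => AP.APContainsRed  -- irrelevant: only used for c ∈ {red, white, blue}

/-- The small-step semantics `→_EC` of external commands, as a function. -/
def stepEC (e : ExtCom) (st : State) : State :=
  match st with
  | .Wrong => .Wrong
  | .Sigma b i =>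
    match e with
    | .IsFull => if baysFullB b then st else .Wrong
    | .NotFull => if baysFullB b then .Wrong else st
    | .HasColor => if containsC b (requestedColor i) then st else .Wrong
    | .DoesNotHaveColor => if containsC b (requestedColor i) then .Wrong else st
    | .Store c =>
      match findColor Color.empty 1 b with
      | some n => .Sigma (setBay b n c) i
      | none => .Wrong
    | .Retrieve c =>
      match findColor c 1 b with
      | some n => .Sigma (setBay b n Color.empty) i
      | none => .Wrong

/-- The labeled small-step semantics of internal commands: a step carries
`some e` when it executes the external command `e`, and `none` otherwise. -/
inductive StepL : IntCom × State → Option ExtCom → IntCom × State → Prop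
  | ext (e : ExtCom) (st : State) :
      StepL (.Ext e, st) (some e) (.Skip, stepEC e st)
  | seq_skip (t : IntCom) (st : State) :
      StepL (.Seq .Skip t, st) none (t, st)
  | seq_step {t1 t1' t2 : IntCom} {st st' : State} {l : Option ExtCom} :
      StepL (t1, st) l (t1', st') →
      StepL (.Seq t1 t2, st) l (.Seq t1' t2, st')
  | if_true {p : AP} {t1 t2 : IntCom} {st : State} :
      evalAtomicProp p st = true → StepL (.If p t1 t2, st) none (t1, st)
  | if_false {p : AP} {t1 t2 : IntCom} {st : State} :
      evalAtomicProp p st = false → StepL (.If p t1 t2, st) none (t2, st)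

/-- The small-step semantics `→_IC` of internal commands. -/
def StepIC (c c' : IntCom × State) : Prop := ∃ l, StepL c l c'

/-- `⟨t, σ⟩ ↝ ψ`: evaluation of `t` from `σ` reaches `⟨Skip, ψ⟩`. -/
def Evaluates (t : IntCom) (σ ψ : State) : Prop :=
  Relation.ReflTransGen StepIC (t, σ) (IntCom.Skip, ψ)

/-- `EmitsTo c tr c'`: configuration `c` multi-steps to `c'` executing exactly the
external commands of `tr`, in order. -/
inductive EmitsTo : IntCom × State → List ExtCom → IntCom × State → Prop
  | refl (c : IntCom × State) : EmitsTo c [] c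
  | step {c c' c'' : IntCom × State} {l : Option ExtCom} {tr : List ExtCom} :
      StepL c l c' → EmitsTo c' tr c'' → EmitsTo c (l.toList ++ tr) c''

/-- The protocol term `spec`. -/
def spec : IntCom :=
  .If .APHasStoreRequest
    (.If .APBaysFull (.Ext .IsFull)
      (.Seq (.Ext .NotFull)
        (.If .APRequestRed (.Ext (.Store .red))
          (.If .APRequestWhite (.Ext (.Store .white))
            (.If .APRequestBlue (.Ext (.Store .blue)) .Skip)))))
    (.If .APHasRetrieveRequest
      (.If .APRequestRed
        (.If .APContainsRed (.Seq (.Ext .HasColor) (.Ext (.Retrieve .red)))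
          (.Ext .DoesNotHaveColor))
        (.If .APRequestWhite
          (.If .APContainsWhite (.Seq (.Ext .HasColor) (.Ext (.Retrieve .white)))
            (.Ext .DoesNotHaveColor))
          (.If .APRequestBlue
            (.If .APContainsBlue (.Seq (.Ext .HasColor) (.Ext (.Retrieve .blue)))
              (.Ext .DoesNotHaveColor))
            .Skip)))
      .Skip)

/-- `Generates t σ tr`: the trace `tr` is generated by evaluating `t` from `σ`,
restarting `spec` in the resulting state whenever evaluation reaches `Skip`
(for as long as commands of `tr` remain). -/
inductive Generates : IntCom → State → List ExtCom → Prop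
  | nil (t : IntCom) (σ : State) : Generates t σ []
  | emit {t t' : IntCom} {σ σ' : State} {e : ExtCom} {tr : List ExtCom} :
      EmitsTo (t, σ) [e] (t', σ') → Generates t' σ' tr → Generates t σ (e :: tr)
  | restart {t : IntCom} {σ σ' : State} {tr : List ExtCom} :
      EmitsTo (t, σ) [] (.Skip, σ') → Generates spec σ' tr → Generates t σ tr

/-- Execute a list of external commands from a state. -/
def runTrace (st : State) : List ExtCom → State
  | [] => st
  | e :: tr => runTrace (stepEC e st) tr

/-- Evaluate an internal command from a state up to (and including) the next
external command, returning that command (or `none` if evaluation reaches `Skip`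
without executing one), the remaining internal command (or `none`), and the
resulting state. -/
def evalUntilNextCom (st : State) : IntCom → Option ExtCom × Option IntCom × State
  | .Skip => (none, none, st)
  | .Ext e => (some e, none, stepEC e st)
  | .Seq t1 t2 =>
    match evalUntilNextCom st t1 with
    | (none, _, st') => evalUntilNextCom st' t2
    | (some e, none, st') => (some e, some t2, st')
    | (some e, some t1', st') => (some e, some (.Seq t1' t2), st')
  | .If p t1 t2 => if evalAtomicProp p st then evalUntilNextCom st t1 else evalUntilNextCom st t2

/-- The trace decider. -/
def isTrace (t : IntCom) (tr : List ExtCom) (st : State) : Bool :=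
  match tr with
  | [] => true
  | com :: tr' =>
    match evalUntilNextCom st t with
    | (none, _, _) => false
    | (some com', none, st') => com = com' && isTrace spec tr' st'
    | (some com', some t', st') => com = com' && isTrace t' tr' st'
termination_by tr.length
decreasing_by all_goals simp

/-- `findColor` succeeds when some bay in the searched range holds the color. -/
theorem findColor_ne_none {c : Color} {b : Bays} {m : ℕ} (hm : m ≤ 9) (hc : bf b m = c)
    (n : ℕ) (hn : n ≤ m) : findColor c n b ≠ none := by
  induction hn using Nat.decreasingInduction with
  | self => rw [findColor]; simp [hm, hc]
  | of_succ k hk ih =>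
    rw [findColor, dif_pos (by omega)]
    split_ifs
    · simp
    · exact ih

theorem stepEC_store_ne_wrong {b : Bays} (h : baysFullB b = false) (c : Color) (i : Input) :
    stepEC (.Store c) (.Sigma b i) ≠ .Wrong := by
  obtain ⟨m, hm, hc⟩ := List.all_eq_false.1 h
  rw [List.mem_range'_1] at hm
  have hfind := findColor_ne_none (c := .empty) (b := b) (m := m) (by omega) (by simpa using hc)
    1 hm.1
  simp only [stepEC]
  split <;> simp_all

theorem stepEC_retrieve_ne_wrong {b : Bays} {c : Color} (h : containsC b c = true) (i : Input) :
    stepEC (.Retrieve c) (.Sigma b i) ≠ .Wrong := by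
  obtain ⟨m, hm, hc⟩ := List.any_eq_true.1 h
  rw [List.mem_range'_1] at hm
  have hfind := findColor_ne_none (c := c) (b := b) (m := m) (by omega) (by simpa using hc) 1 hm.1
  simp only [stepEC]
  split <;> simp_all

/-- The weakest precondition of an internal command with respect to a postcondition. -/
def weakestPre : IntCom → (State → Prop) → State → Prop
  | .Skip, Q, σ => Q σ
  | .Ext e, Q, σ => Q (stepEC e σ)
  | .Seq t1 t2, Q, σ => weakestPre t1 (weakestPre t2 Q) σ
  | .If p t1 t2, Q, σ =>
    if evalAtomicProp p σ = true then weakestPre t1 Q σ else weakestPre t2 Q σ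

/-- The error state satisfies no weakest precondition of a postcondition that excludes it. -/
theorem not_weakestPre_wrong (t : IntCom) {Q : State → Prop} (hQ : ¬ Q .Wrong) :
    ¬ weakestPre t Q .Wrong := by
  induction t generalizing Q with
  | Skip => exact hQ
  | Ext e => exact hQ
  | Seq t1 t2 ih1 ih2 => exact ih1 (ih2 hQ)
  | If p t1 t2 ih1 ih2 => simpa [weakestPre, evalAtomicProp] using ih2 hQ

/-- Weakest preconditions are preserved by steps. -/
theorem weakestPre_of_stepL {c c' : IntCom × State} {l : Option ExtCom} (h : StepL c l c')
    {Q : State → Prop} (hc : weakestPre c.1 Q c.2) : weakestPre c'.1 Q c'.2 := by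
  induction h generalizing Q with
  | ext e st => exact hc
  | seq_skip t st => exact hc
  | seq_step _ ih => exact ih (Q := weakestPre _ Q) hc
  | if_true hp => simpa [weakestPre, hp] using hc
  | if_false hp => simpa [weakestPre, hp] using hc

/-- Weakest preconditions are preserved by emitting runs. -/
theorem weakestPre_of_emitsTo {c c' : IntCom × State} {tr : List ExtCom} (h : EmitsTo c tr c')
    {Q : State → Prop} (hc : weakestPre c.1 Q c.2) : weakestPre c'.1 Q c'.2 := by
  induction h with
  | refl => exact hc
  | step hs _ ih => exact ih (weakestPre_of_stepL hs hc)

theorem StepL.runTrace_eq {c c' : IntCom × State} {l : Option ExtCom} (h : StepL c l c') :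
    runTrace c.2 l.toList = c'.2 := by
  induction h with
  | seq_step _ ih => exact ih
  | _ => rfl

theorem runTrace_append (σ : State) (tr tr' : List ExtCom) :
    runTrace σ (tr ++ tr') = runTrace (runTrace σ tr) tr' := by
  induction tr generalizing σ with
  | nil => rfl
  | cons e tr ih => exact ih _

/-- The state reached by an emitting run is the one reached by executing its trace. -/
theorem EmitsTo.runTrace_eq {c c' : IntCom × State} {tr : List ExtCom} (h : EmitsTo c tr c') :
    runTrace c.2 tr = c'.2 := by
  induction h with
  | refl => rfl
  | step hs _ ih => rw [runTrace_append, hs.runTrace_eq, ih]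

theorem weakestPre_spec {σ : State} (hσ : σ ≠ .Wrong) : weakestPre spec (· ≠ .Wrong) σ := by
  cases σ with
  | Wrong => exact absurd rfl hσ
  | Sigma b i =>
    cases i with
    | StoreRequest c =>
      cases hfull : baysFullB b <;> cases c <;>
        simp [spec, weakestPre, evalAtomicProp, evalAP, requestedColor, hfull,
          stepEC.eq_def .IsFull, stepEC.eq_def .NotFull, stepEC_store_ne_wrong]
    | RetrieveRequest c =>
      cases hmem : containsC b c <;> cases c <;>
        simp [spec, weakestPre, evalAtomicProp, evalAP, requestedColor, hmem,
          stepEC.eq_def .HasColor, stepEC.eq_def .DoesNotHaveColor, stepEC_retrieve_ne_wrong]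

/-- A trace generated from a configuration whose weakest precondition holds is safe. -/
theorem Generates.runTrace_ne_wrong {t : IntCom} {σ : State} {tr : List ExtCom}
    (h : Generates t σ tr) (hσ : weakestPre t (· ≠ .Wrong) σ) :
    ∀ tr' : List ExtCom, tr' <+: tr → runTrace σ tr' ≠ .Wrong := by
  have start_ne_wrong {t : IntCom} {σ : State} (hσ : weakestPre t (· ≠ .Wrong) σ) :
      σ ≠ .Wrong := by
    rintro rfl
    exact not_weakestPre_wrong t (by simp) hσ
  induction h with
  | nil t σ =>
    intro tr' htr
    rw [List.prefix_nil.1 htr]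
    exact start_ne_wrong hσ
  | emit hem _ ih =>
    intro tr' htr
    rcases List.prefix_cons_iff.1 htr with rfl | ⟨s, rfl, hs⟩
    · exact start_ne_wrong hσ
    · have hrun := ih (weakestPre_of_emitsTo hem hσ) s hs
      have hstate := hem.runTrace_eq
      dsimp only at hstate
      rw [← hstate] at hrun
      exact hrun
  | restart hem _ ih =>
    have hrun := ih (weakestPre_spec (weakestPre_of_emitsTo hem hσ))
    have hstate := hem.runTrace_eq
    dsimp only at hstate
    rw [← hstate] at hrun
    exact hrun

/-- if a finite trace `tr` is generated by `spec` from a valid state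
`σ ≠ Wrong`, then executing `tr` from `σ` under `→_EC` never produces `Wrong`. -/
theorem generated_trace_never_goes_wrong (σ : State) (hσ : σ ≠ State.Wrong)
    (tr : List ExtCom) (hgen : Generates spec σ tr) :
    ∀ tr' : List ExtCom, tr' <+: tr → runTrace σ tr' ≠ State.Wrong := by
  exact hgen.runTrace_ne_wrong (weakestPre_spec hσ)
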